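/- The functions v and u satisfy the energy identity q^{-1}|u(t)|^q + p^{-1}(a₁|v⁺(t)|^p + b₁|v⁻(t)|^p) = a₁/q for all t ∈ ℝ, and both v and u are 2π_p-periodic functions. -/

import Mathlib

/-- The one-dimensional `p`-Laplacian nonlinearity `φ_p(s) = |s|^{p-2} s`. -/
noncomputable def phi (p s : ℝ) : ℝ := |s| ^ (p - 2) * s

/-- The `p`-analogue of `π`: `π_p = 2π (p-1)^{1/p} / (p sin(π/p))`. -/
noncomputable def pip (p : ℝ) : ℝ :=
  2 * Real.pi * (p - 1) ^ (1 / p) / (p * Real.sin (Real.pi / p))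

/-- The potential energy `a (x⁺)^p + b (x⁻)^p` of the asymmetric oscillator. -/
noncomputable def potential (p a b x : ℝ) : ℝ := a * max x 0 ^ p + b * max (-x) 0 ^ p

/-- The reciprocal speed at position `x` on the level set of energy `K`. -/
noncomputable def slowness (p a b K x : ℝ) : ℝ := ((p - 1) / (K - potential p a b x)) ^ (1 / p)

lemma potential_neg (p a b x : ℝ) : potential p a b (-x) = potential p b a x := by
  simp [potential, add_comm]

lemma potential_of_nonneg {p a b x : ℝ} (hp : 0 < p) (hx : 0 ≤ x) :
    potential p a b x = a * x ^ p := by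
  have : -x ≤ 0 := by linarith
  simp [potential, hx, this, Real.zero_rpow hp.ne']

lemma pip_pos {p : ℝ} (hp : 1 < p) : 0 < pip p := by
  have h0 : 0 < p := by linarith
  have h1 : 0 < Real.sin (Real.pi / p) :=
    Real.sin_pos_of_pos_of_lt_pi (by positivity) (div_lt_self Real.pi_pos hp)
  have h2 : 0 < (p - 1) ^ (1 / p) := Real.rpow_pos_of_pos (by linarith) _
  have := Real.pi_pos
  unfold pip
  positivity

lemma image_const_mul_rpow_Ioo {A r : ℝ} (hA : 0 < A) (hr : 0 < r) :
    (fun y : ℝ => A * y ^ r) '' Set.Ioo 0 1 = Set.Ioo 0 A := by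
  ext x
  constructor
  · rintro ⟨y, ⟨hy0, hy1⟩, rfl⟩
    have h1 := Real.rpow_pos_of_pos hy0 r
    have h2 := Real.rpow_lt_one hy0.le hy1 hr
    exact ⟨by positivity, by nlinarith⟩
  · rintro ⟨hx0, hx1⟩
    have h0 : 0 < x / A := by positivity
    refine ⟨(x / A) ^ r⁻¹, ⟨by positivity,
      Real.rpow_lt_one h0.le ((div_lt_one hA).2 hx1) (inv_pos.2 hr)⟩, ?_⟩
    simp only
    rw [Real.rpow_inv_rpow h0.le hr.ne']
    field_simp

lemma lintegral_slowness_pos {p a b K A : ℝ} (hp : 1 < p) (ha : 0 < a) (hA : 0 < A)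
    (hK : a * A ^ p = K) :
    ∫⁻ x in Set.Ioo 0 A, ENNReal.ofReal (slowness p a b K x)
      = ENNReal.ofReal (a ^ (-(1 : ℝ) / p) * (pip p / 2)) := by
  have h0 : 0 < p := by linarith
  have hr : 0 < 1 / p := by positivity
  have hr1 : 0 < 1 - 1 / p := by rw [sub_pos, div_lt_one h0]; exact hp
  have hβ := ProbabilityTheory.beta_pos hr hr1
  have hβv : ProbabilityTheory.beta (1 / p) (1 - 1 / p) = Real.pi / Real.sin (Real.pi / p) := by
    rw [ProbabilityTheory.beta, Real.Gamma_mul_Gamma_one_sub]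
    simp [div_eq_mul_inv]
  rw [← image_const_mul_rpow_Ioo hA hr,
    MeasureTheory.lintegral_image_eq_lintegral_abs_deriv_mul
      (f' := fun y => A * (1 / p * y ^ (1 / p - 1)))
      measurableSet_Ioo]
  · have key : ∀ y ∈ Set.Ioo (0 : ℝ) 1,
        ENNReal.ofReal |A * (1 / p * y ^ (1 / p - 1))| *
          ENNReal.ofReal (slowness p a b K (A * y ^ (1 / p))) =
        ENNReal.ofReal (a ^ (-(1 : ℝ) / p) * (pip p / 2)) *
          ENNReal.ofReal (1 / ProbabilityTheory.beta (1 / p) (1 - 1 / p) * y ^ (1 / p - 1) *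
            (1 - y) ^ ((1 - 1 / p) - 1)) := by
      rintro y ⟨hy0, hy1⟩
      have hy : 0 < y ^ (1 / p - 1) := Real.rpow_pos_of_pos hy0 _
      have hpip := pip_pos hp
      rw [← ENNReal.ofReal_mul (abs_nonneg _), ← ENNReal.ofReal_mul (by positivity),
        abs_of_pos (by positivity)]
      congr 1
      have hs : slowness p a b K (A * y ^ (1 / p)) =
          (p - 1) ^ (1 / p) * (a ^ (-(1 : ℝ) / p) / A * (1 - y) ^ (-(1 / p))) := by
        rw [slowness, potential_of_nonneg h0 (by positivity),
          Real.mul_rpow hA.le (by positivity), ← Real.rpow_mul hy0.le, one_div_mul_cancel h0.ne',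
          Real.rpow_one, show K - a * (A ^ p * y) = a * A ^ p * (1 - y) by rw [← hK]; ring,
          Real.div_rpow (by linarith) (mul_nonneg (by positivity) (by linarith)),
          Real.mul_rpow (by positivity) (by linarith), Real.mul_rpow ha.le (by positivity),
          ← Real.rpow_mul hA.le, mul_one_div_cancel h0.ne', Real.rpow_one,
          Real.rpow_neg (by linarith : 0 ≤ 1 - y), neg_div, Real.rpow_neg ha.le]
        field_simp
      rw [hs, hβv, show (1 - 1 / p) - 1 = -(1 / p) by ring, pip]
      have hsin : 0 < Real.sin (Real.pi / p) :=
        Real.sin_pos_of_pos_of_lt_pi (by positivity) (div_lt_self Real.pi_pos hp)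
      have := Real.pi_pos
      field_simp
    rw [MeasureTheory.setLIntegral_congr_fun measurableSet_Ioo key,
      MeasureTheory.lintegral_const_mul _ (by fun_prop), ← ProbabilityTheory.lintegral_betaPDF,
      ProbabilityTheory.lintegral_betaPDF_eq_one hr hr1, mul_one]
  · intro y hy
    exact ((Real.hasDerivAt_rpow_const (Or.inl hy.1.ne')).const_mul A).hasDerivWithinAt
  · intro y hy z hz h
    exact Real.rpow_left_injOn hr.ne' hy.1.le hz.1.le (mul_left_cancel₀ hA.ne' h)

lemma lintegral_slowness {p a b K A B : ℝ} (hp : 1 < p) (ha : 0 < a) (hb : 0 < b) (hA : 0 < A)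
    (hB : 0 < B) (hKA : a * A ^ p = K) (hKB : b * B ^ p = K)
    (hab : a ^ (-(1 : ℝ) / p) + b ^ (-(1 : ℝ) / p) = 2) :
    ∫⁻ x in Set.Ioo (-B) A, ENNReal.ofReal (slowness p a b K x) = ENNReal.ofReal (pip p) := by
  have hpip := pip_pos hp
  have hneg : ∫⁻ x in Set.Ioo (-B) 0, ENNReal.ofReal (slowness p a b K x)
      = ENNReal.ofReal (b ^ (-(1 : ℝ) / p) * (pip p / 2)) := by
    have himg : (fun x : ℝ => -x) '' Set.Ioo 0 B = Set.Ioo (-B) 0 := by simp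
    rw [← himg, MeasureTheory.lintegral_image_eq_lintegral_abs_deriv_mul (f' := fun _ => -1)
      measurableSet_Ioo (fun x _ => (hasDerivAt_neg x).hasDerivWithinAt) neg_injective.injOn]
    simp only [slowness, potential_neg, abs_neg, abs_one, ENNReal.ofReal_one, one_mul]
    exact lintegral_slowness_pos hp hb hB hKB
  rw [← Set.Ioc_union_Ioo_eq_Ioo (neg_lt_zero.2 hB).le hA,
    MeasureTheory.lintegral_union measurableSet_Ioo
      (Set.disjoint_left.2 fun x hx hx' => absurd hx.2 (not_le.2 hx'.1)),
    MeasureTheory.restrict_Ioo_eq_restrict_Ioc.symm, hneg,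
    lintegral_slowness_pos hp ha hA hKA, ← ENNReal.ofReal_add (by positivity) (by positivity)]
  congr 1
  linear_combination (pip p / 2) * hab

lemma phi_neg (p s : ℝ) : phi p (-s) = -phi p s := by simp [phi]

lemma phi_zero (p : ℝ) : phi p 0 = 0 := by simp [phi]

lemma phi_pos {p s : ℝ} (hs : 0 < s) : 0 < phi p s :=
  mul_pos (Real.rpow_pos_of_pos (abs_pos.2 hs.ne') _) hs

lemma phi_neg_iff {p s : ℝ} : phi p s < 0 ↔ s < 0 := by
  refine ⟨fun h => ?_, fun h => ?_⟩
  · by_contra! hs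
    exact h.not_ge (mul_nonneg (by positivity) hs)
  · have := phi_pos (p := p) (neg_pos.2 h)
    rw [phi_neg] at this
    linarith

lemma phi_eq_zero_iff {p s : ℝ} : phi p s = 0 ↔ s = 0 := by
  refine ⟨fun h => ?_, fun h => h ▸ phi_zero p⟩
  by_contra hs
  exact mul_ne_zero (Real.rpow_pos_of_pos (abs_pos.2 hs) _).ne' hs h

lemma continuous_phi {p : ℝ} (hp : 2 ≤ p) : Continuous (phi p) :=
  (continuous_abs.rpow_const fun _ => Or.inr (by linarith)).mul continuous_id

lemma abs_phi {p : ℝ} (hp : 1 < p) (s : ℝ) : |phi p s| = |s| ^ (p - 1) := by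
  rcases eq_or_ne s 0 with rfl | hs
  · simp [phi, Real.zero_rpow (by linarith : p - 1 ≠ 0)]
  · have hs' := abs_pos.2 hs
    rw [phi, abs_mul, abs_of_pos (Real.rpow_pos_of_pos hs' _), ← Real.rpow_add_one hs'.ne']
    ring_nf

lemma abs_phi_rpow_conj {p q : ℝ} (hp : 1 < p) (hq : q = p / (p - 1)) (s : ℝ) :
    |phi p s| ^ q = |s| ^ p := by
  have h : p - 1 ≠ 0 := by linarith
  rw [abs_phi hp, ← Real.rpow_mul (abs_nonneg s), hq, mul_div_cancel₀ _ h]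

lemma phi_conj_phi {p q : ℝ} (hp : 1 < p) (hq : q = p / (p - 1)) (s : ℝ) :
    phi q (phi p s) = s := by
  rcases eq_or_ne s 0 with rfl | hs
  · simp [phi_zero]
  · have hs' := abs_pos.2 hs
    have h : p - 1 ≠ 0 := by linarith
    have he : (p - 1) * (q - 2) = -(p - 2) := by rw [hq]; field_simp; ring
    have hpow := (Real.rpow_pos_of_pos hs' (p - 2)).ne'
    calc phi q (phi p s) = (|s| ^ (p - 2))⁻¹ * (|s| ^ (p - 2) * s) := by
          rw [← Real.rpow_neg hs'.le, ← he, Real.rpow_mul hs'.le, ← abs_phi hp]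
          rfl
      _ = s := inv_mul_cancel_left₀ hpow s

lemma hasDerivAt_max_zero_rpow {p : ℝ} (hp : 2 ≤ p) (x : ℝ) :
    HasDerivAt (fun x => max x 0 ^ p) (p * phi p (max x 0)) x := by
  have hne : ∀ y : ℝ, y ≠ 0 → HasDerivAt (fun x => max x 0 ^ p) (p * phi p (max y 0)) y := by
    intro y hy
    rcases hy.lt_or_gt with h | h
    · rw [max_eq_right h.le, phi_zero, mul_zero]
      refine (hasDerivAt_const y ((0 : ℝ) ^ p)).congr_of_eventuallyEq ?_
      filter_upwards [gt_mem_nhds h] with z hz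
      rw [max_eq_right hz.le]
    · rw [max_eq_left h.le]
      refine HasDerivAt.congr_of_eventuallyEq (f := fun x : ℝ => x ^ p) ?_ ?_
      · refine (Real.hasDerivAt_rpow_const (Or.inl h.ne')).congr_deriv ?_
        rw [phi, abs_of_pos h, ← Real.rpow_add_one h.ne']
        ring_nf
      · filter_upwards [lt_mem_nhds h] with z hz
        rw [max_eq_left hz.le]
  refine hasDerivAt_of_hasDerivAt_of_ne' (g := fun y => p * phi p (max y 0)) (x := 0) hne ?_ ?_ x
  · exact ((continuous_id.max continuous_const).rpow_const
      fun _ => Or.inr (by linarith)).continuousAt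
  · exact (((continuous_phi hp).comp (continuous_id.max continuous_const)).const_mul p).continuousAt

lemma hasDerivAt_potential {p : ℝ} (hp : 2 ≤ p) (a b x : ℝ) :
    HasDerivAt (potential p a b)
      (p * (a * phi p (max x 0) - b * phi p (max (-x) 0))) x := by
  have h := ((hasDerivAt_max_zero_rpow hp x).const_mul a).add
    (((hasDerivAt_max_zero_rpow hp (-x)).comp x (hasDerivAt_neg x)).const_mul b)
  exact h.congr_deriv (by ring)

/-- A solution `v`, with velocity `w`, of the asymmetric equation with coefficients `a`, `b`
on the energy level `K`. -/
structure IsSolution (p a b K : ℝ) (v w : ℝ → ℝ) : Prop where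
  hasDerivAt : ∀ t, HasDerivAt v (w t) t
  hasDerivAt_phi : ∀ t, HasDerivAt (fun s => phi p (w s))
    (-a * phi p (max (v t) 0) + b * phi p (max (-v t) 0)) t
  energy : ∀ t, (p - 1) * |w t| ^ p + potential p a b (v t) = K

lemma isSolution_of_hasDerivAt {p a b : ℝ} {v w : ℝ → ℝ} (hp : 2 ≤ p)
    (hv : ∀ t, HasDerivAt v (w t) t)
    (hode : ∀ t, HasDerivAt (fun s => phi p (w s))
      (-a * phi p (max (v t) 0) + b * phi p (max (-v t) 0)) t) :
    IsSolution p a b ((p - 1) * |w 0| ^ p + potential p a b (v 0)) v w := by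
  have hp1 : 1 < p := by linarith
  obtain ⟨q, hq⟩ : ∃ q, q = p / (p - 1) := ⟨_, rfl⟩
  have hq1 : 1 < q := by rw [hq, lt_div_iff₀] <;> linarith
  have hpq : (p - 1) * q = p := by rw [hq, mul_div_cancel₀]; linarith
  have hder : ∀ t, HasDerivAt
      (fun t => (p - 1) * |phi p (w t)| ^ q + potential p a b (v t)) 0 t := by
    intro t
    have h := (((hasDerivAt_abs_rpow (phi p (w t)) hq1).comp t (hode t)).const_mul (p - 1)).add
      ((hasDerivAt_potential hp a b (v t)).comp t (hv t))
    refine h.congr_deriv ?_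
    have hw : |phi p (w t)| ^ (q - 2) * phi p (w t) = w t := phi_conj_phi hp1 hq (w t)
    rw [mul_assoc q, hw]
    linear_combination (b * phi p (max (-v t) 0) - a * phi p (max (v t) 0)) * w t * hpq
  refine ⟨hv, hode, fun t => ?_⟩
  have h := is_const_of_deriv_eq_zero (fun t => (hder t).differentiableAt)
    (fun t => (hder t).deriv) t 0
  simpa only [abs_phi_rpow_conj hp1 hq] using h

namespace IsSolution

variable {p a b K A B t₀ : ℝ} {v w : ℝ → ℝ}

lemma neg (h : IsSolution p a b K v w) :
    IsSolution p b a K (fun t => -v t) (fun t => -w t) where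
  hasDerivAt t := (h.hasDerivAt t).neg
  hasDerivAt_phi t := by
    simp only [phi_neg]
    exact (h.hasDerivAt_phi t).neg.congr_deriv (by rw [neg_neg]; ring)
  energy t := by simpa [potential_neg] using h.energy t

lemma comp_neg (h : IsSolution p a b K v w) :
    IsSolution p a b K (fun t => v (-t)) (fun t => -w (-t)) where
  hasDerivAt t := ((h.hasDerivAt (-t)).comp t (hasDerivAt_neg t)).congr_deriv (by ring)
  hasDerivAt_phi t := by
    simp only [phi_neg]
    exact ((h.hasDerivAt_phi (-t)).comp t (hasDerivAt_neg t)).neg.congr_deriv (by ring)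
  energy t := by simpa using h.energy (-t)

lemma continuous (h : IsSolution p a b K v w) : Continuous v :=
  continuous_iff_continuousAt.2 fun t => (h.hasDerivAt t).continuousAt

lemma continuous_phi (h : IsSolution p a b K v w) : Continuous fun t => phi p (w t) :=
  continuous_iff_continuousAt.2 fun t => (h.hasDerivAt_phi t).continuousAt

lemma potential_le (h : IsSolution p a b K v w) (hp : 1 < p) (t : ℝ) :
    potential p a b (v t) ≤ K := by
  have := h.energy t
  have : 0 ≤ (p - 1) * |w t| ^ p := mul_nonneg (by linarith) (by positivity)
  linarith

lemma le_of_energy (h : IsSolution p a b K v w) (hp : 1 < p) (ha : 0 < a) (hA : 0 < A)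
    (hKA : a * A ^ p = K) (t : ℝ) : v t ≤ A := by
  by_contra! hlt
  have h1 := h.potential_le hp t
  rw [potential_of_nonneg (by linarith) (hA.trans hlt).le, ← hKA] at h1
  exact h1.not_gt (mul_lt_mul_of_pos_left (Real.rpow_lt_rpow hA.le hlt (by linarith)) ha)

lemma neg_le_of_energy (h : IsSolution p a b K v w) (hp : 1 < p) (hb : 0 < b) (hB : 0 < B)
    (hKB : b * B ^ p = K) (t : ℝ) : -B ≤ v t := by
  have := h.neg.le_of_energy hp hb hB hKB t
  linarith

lemma eq_of_velocity_eq_zero (h : IsSolution p a b K v w) (hp : 1 < p) (ha : 0 < a)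
    (hA : 0 < A) (hKA : a * A ^ p = K) {t : ℝ} (hw : w t = 0) (hv : 0 ≤ v t) : v t = A := by
  have h1 := h.energy t
  have hp0 : p ≠ 0 := by linarith
  rw [hw, abs_zero, Real.zero_rpow hp0, mul_zero, zero_add, potential_of_nonneg (by linarith) hv,
    ← hKA] at h1
  exact Real.rpow_left_injOn hp0 hv hA.le (mul_left_cancel₀ ha.ne' h1)

lemma abs_velocity_mul_slowness (h : IsSolution p a b K v w) (hp : 1 < p) {t : ℝ}
    (hw : w t ≠ 0) : |w t| * slowness p a b K (v t) = 1 := by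
  have hw' := abs_pos.2 hw
  have hp1 : p - 1 ≠ 0 := by linarith
  have hp0 : p ≠ 0 := by linarith
  have h1 : (p - 1) / (K - potential p a b (v t)) = (|w t| ^ p)⁻¹ := by
    rw [← h.energy t, add_sub_cancel_right]
    have := (Real.rpow_pos_of_pos hw' p).ne'
    field_simp
  rw [slowness, h1, Real.inv_rpow (by positivity), ← Real.rpow_mul hw'.le, mul_one_div_cancel hp0,
    Real.rpow_one, mul_inv_cancel₀ hw'.ne']

lemma strictAntiOn (h : IsSolution p a b K v w) {t₁ : ℝ} (hw : ∀ t ∈ Set.Ioo t₀ t₁, w t < 0) :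
    StrictAntiOn v (Set.Icc t₀ t₁) :=
  strictAntiOn_of_deriv_neg (convex_Icc t₀ t₁) h.continuous.continuousOn fun t ht => by
    rw [(h.hasDerivAt t).deriv]
    exact hw t (by simpa using ht)

/-- The elapsed time while moving downwards is the integral of the slowness over the positions. -/
lemma lintegral_slowness_eq (h : IsSolution p a b K v w) (hp : 1 < p) {t₁ : ℝ} (ht : t₀ ≤ t₁)
    (hw : ∀ t ∈ Set.Ioo t₀ t₁, w t < 0) :
    ∫⁻ x in Set.Ioo (v t₁) (v t₀), ENNReal.ofReal (slowness p a b K x)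
      = ENNReal.ofReal (t₁ - t₀) := by
  have hanti := h.strictAntiOn hw
  have himg : v '' Set.Ioo t₀ t₁ = Set.Ioo (v t₁) (v t₀) := by
    refine Set.Subset.antisymm ?_ (intermediate_value_Ioo' ht h.continuous.continuousOn)
    rintro _ ⟨t, htm, rfl⟩
    exact ⟨hanti (Set.Ioo_subset_Icc_self htm) (Set.right_mem_Icc.2 ht) htm.2,
      hanti (Set.left_mem_Icc.2 ht) (Set.Ioo_subset_Icc_self htm) htm.1⟩
  rw [← himg, MeasureTheory.lintegral_image_eq_lintegral_abs_deriv_mul measurableSet_Ioo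
    (fun t _ => (h.hasDerivAt t).hasDerivWithinAt)
    (hanti.injOn.mono Set.Ioo_subset_Icc_self)]
  have key : ∀ t ∈ Set.Ioo t₀ t₁,
      ENNReal.ofReal |w t| * ENNReal.ofReal (slowness p a b K (v t)) = 1 := by
    intro t htm
    rw [← ENNReal.ofReal_mul (abs_nonneg _), h.abs_velocity_mul_slowness hp (hw t htm).ne,
      ENNReal.ofReal_one]
  rw [MeasureTheory.setLIntegral_congr_fun measurableSet_Ioo key]
  simp

/-- A turning point at the maximum is followed by a nonempty interval of downward motion. -/
lemma exists_velocity_neg (h : IsSolution p a b K v w) (ha : 0 < a) (hw : w t₀ = 0)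
    (hv : 0 < v t₀) : ∃ ε > 0, ∀ t ∈ Set.Ioc t₀ (t₀ + ε), w t < 0 := by
  have hd := h.hasDerivAt_phi t₀
  rw [max_eq_left hv.le, max_eq_right (by linarith : -v t₀ ≤ 0), phi_zero, mul_zero, add_zero] at hd
  have hneg : -a * phi p (v t₀) < 0 := by nlinarith [phi_pos (p := p) hv]
  have hs := (hasDerivAt_iff_tendsto_slope.1 hd).eventually (gt_mem_nhds hneg)
  rw [eventually_nhdsWithin_iff, Metric.eventually_nhds_iff] at hs
  obtain ⟨ε, hε, hs⟩ := hs
  refine ⟨ε / 2, by positivity, fun t ht => ?_⟩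
  have h1 : t₀ < t := ht.1
  have h2 := hs (y := t) (by
    rw [Real.dist_eq, abs_of_pos (by linarith)]; linarith [ht.2]) (by simpa using h1.ne')
  rw [slope_def_field, hw, phi_zero, sub_zero, div_neg_iff] at h2
  rcases h2 with h2 | h2
  · linarith [h2.2]
  · exact phi_neg_iff.1 h2.1

/-- The downward motion continues up to a given time unless the velocity vanishes before. -/
lemma velocity_neg (h : IsSolution p a b K v w) (ha : 0 < a) (hw : w t₀ = 0) (hv : 0 < v t₀)
    {t₁ : ℝ} (hne : ∀ t ∈ Set.Ioo t₀ t₁, w t ≠ 0) : ∀ t ∈ Set.Ioo t₀ t₁, w t < 0 := by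
  obtain ⟨ε, hε, hneg⟩ := h.exists_velocity_neg ha hw hv
  rintro t ⟨ht0, ht1⟩
  by_contra! hpos
  have hlt : t₀ + ε < t := by
    by_contra! hle
    exact (hneg t ⟨ht0, hle⟩).not_ge hpos
  have h1 : phi p (w (t₀ + ε)) < 0 := phi_neg_iff.2 (hneg _ ⟨by linarith, le_rfl⟩)
  have h2 : 0 ≤ phi p (w t) := by
    by_contra! h'
    exact (phi_neg_iff.1 h').not_ge hpos
  obtain ⟨s, hs, hs0⟩ := intermediate_value_Icc hlt.le h.continuous_phi.continuousOn ⟨h1.le, h2⟩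
  exact hne s ⟨by linarith [hs.1], by linarith [hs.2]⟩ (phi_eq_zero_iff.1 hs0)

/-- The set of positive times with vanishing velocity, if nonempty, has a least element. -/
lemma exists_first_velocity_zero (h : IsSolution p a b K v w) (ha : 0 < a) (hw : w t₀ = 0)
    (hv : 0 < v t₀) (hex : ∃ t > t₀, w t = 0) :
    ∃ s > t₀, w s = 0 ∧ ∀ t ∈ Set.Ioo t₀ s, w t ≠ 0 := by
  obtain ⟨ε, hε, hneg⟩ := h.exists_velocity_neg ha hw hv
  obtain ⟨r, hr, hr0⟩ := hex
  set Z : Set ℝ := {t | t₀ + ε ≤ t ∧ phi p (w t) = 0} with hZ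
  have hclosed : IsClosed Z :=
    (isClosed_le continuous_const continuous_id).inter
      (isClosed_eq h.continuous_phi continuous_const)
  have hmem : ∀ t > t₀, w t = 0 → t ∈ Z := fun t ht ht0 => by
    refine ⟨?_, phi_eq_zero_iff.2 ht0⟩
    by_contra! hlt
    exact (hneg t ⟨ht, hlt.le⟩).ne ht0
  have hbdd : BddBelow Z := ⟨t₀ + ε, fun t ht => ht.1⟩
  have hs := hclosed.csInf_mem ⟨r, hmem r hr hr0⟩ hbdd
  refine ⟨sInf Z, by linarith [hs.1], phi_eq_zero_iff.1 hs.2, fun t ht ht0 => ?_⟩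
  exact (csInf_le hbdd (hmem t ht.1 ht0)).not_gt ht.2

end IsSolution

/-- A turning point of `v` at its positive maximum. -/
def IsTurningPoint (v w : ℝ → ℝ) (t : ℝ) : Prop := w t = 0 ∧ 0 < v t

lemma exists_pos_mul_rpow_eq {p a K : ℝ} (hp : p ≠ 0) (ha : 0 < a) (hK : 0 < K) :
    ∃ A, 0 < A ∧ a * A ^ p = K := by
  refine ⟨(K / a) ^ p⁻¹, by positivity, ?_⟩
  rw [Real.rpow_inv_rpow (by positivity) hp]
  field_simp

lemma measurable_slowness (p a b K : ℝ) : Measurable (slowness p a b K) := by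
  unfold slowness potential
  fun_prop

lemma slowness_pos {p a b K A B x : ℝ} (hp : 1 < p) (ha : 0 < a) (hb : 0 < b)
    (hKA : a * A ^ p = K) (hKB : b * B ^ p = K) (hx : x ∈ Set.Ioo (-B) A) :
    0 < slowness p a b K x := by
  have hp0 : 0 < p := by linarith
  have hlt : potential p a b x < K := by
    rcases le_total 0 x with h | h
    · rw [potential_of_nonneg hp0 h, ← hKA]
      exact mul_lt_mul_of_pos_left (Real.rpow_lt_rpow h hx.2 hp0) ha
    · have h' : 0 ≤ -x := by linarith
      rw [← neg_neg x, potential_neg, potential_of_nonneg hp0 h', ← hKB]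
      exact mul_lt_mul_of_pos_left (Real.rpow_lt_rpow h' (by linarith [hx.1]) hp0) hb
  exact Real.rpow_pos_of_pos (div_pos (by linarith) (by linarith)) _

namespace IsSolution

variable {p a b K A B t₀ : ℝ} {v w : ℝ → ℝ}

/-- Half a period after a maximum, the solution is at its minimum, moving downwards in between. -/
lemma half_period (h : IsSolution p a b K v w) (hp : 1 < p) (ha : 0 < a) (hb : 0 < b)
    (hA : 0 < A) (hB : 0 < B) (hKA : a * A ^ p = K) (hKB : b * B ^ p = K)
    (hab : a ^ (-(1 : ℝ) / p) + b ^ (-(1 : ℝ) / p) = 2) (ht : IsTurningPoint v w t₀) :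
    (∀ t ∈ Set.Ioo t₀ (t₀ + pip p), w t < 0) ∧
      IsTurningPoint (fun t => -v t) (fun t => -w t) (t₀ + pip p) := by
  have hpip := pip_pos hp
  obtain ⟨hw, hv⟩ := ht
  have hvA := h.eq_of_velocity_eq_zero hp ha hA hKA hw hv.le
  have htot := lintegral_slowness hp ha hb hA hB hKA hKB hab
  have hex : ∃ t > t₀, w t = 0 := by
    by_contra! hne
    have hneg := h.velocity_neg ha hw hv (t₁ := t₀ + (pip p + 1)) fun t ht => hne t ht.1
    have h1 := h.lintegral_slowness_eq hp (by linarith) hneg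
    have h2 := MeasureTheory.lintegral_mono_set (μ := MeasureTheory.volume)
      (f := fun x => ENNReal.ofReal (slowness p a b K x))
      (Set.Ioo_subset_Ioo (h.neg_le_of_energy hp hb hB hKB (t₀ + (pip p + 1))) hvA.le)
    rw [h1, htot, ENNReal.ofReal_le_ofReal_iff hpip.le] at h2
    linarith
  obtain ⟨s, hs, hs0, hsne⟩ := h.exists_first_velocity_zero ha hw hv hex
  have hneg := h.velocity_neg ha hw hv hsne
  have hlt : v s < A := hvA ▸ h.strictAntiOn hneg (Set.left_mem_Icc.2 hs.le)
    (Set.right_mem_Icc.2 hs.le) hs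
  have hvs : v s < 0 := by
    by_contra! hpos
    exact hlt.ne (h.eq_of_velocity_eq_zero hp ha hA hKA hs0 hpos)
  have hvB : -v s = B := h.neg.eq_of_velocity_eq_zero hp hb hB hKB (by simp [hs0]) (by linarith)
  have h1 := h.lintegral_slowness_eq hp hs.le hneg
  rw [hvA, ← neg_neg (v s), hvB, htot, ENNReal.ofReal_eq_ofReal_iff hpip.le (by linarith)] at h1
  obtain rfl : t₀ + pip p = s := by linarith
  exact ⟨hneg, by simp [hs0], by linarith⟩

/-- Two solutions on the same energy level agree for half a period after their maxima. -/
lemma eq_on_half_period {v₁ w₁ v₂ w₂ : ℝ → ℝ} {t₁ t₂ : ℝ} (h₁ : IsSolution p a b K v₁ w₁)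
    (h₂ : IsSolution p a b K v₂ w₂) (hp : 1 < p) (ha : 0 < a) (hb : 0 < b)
    (hA : 0 < A) (hB : 0 < B) (hKA : a * A ^ p = K) (hKB : b * B ^ p = K)
    (hab : a ^ (-(1 : ℝ) / p) + b ^ (-(1 : ℝ) / p) = 2) (ht₁ : IsTurningPoint v₁ w₁ t₁)
    (ht₂ : IsTurningPoint v₂ w₂ t₂) {s : ℝ} (hs : s ∈ Set.Icc 0 (pip p)) :
    v₁ (t₁ + s) = v₂ (t₂ + s) := by
  have htime : ∀ {v w : ℝ → ℝ} {t : ℝ}, IsSolution p a b K v w → IsTurningPoint v w t →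
      ∫⁻ x in Set.Ioo (v (t + s)) A, ENNReal.ofReal (slowness p a b K x) = ENNReal.ofReal s ∧
      v (t + s) ∈ Set.Icc (-B) A := by
    intro v w t h ht
    have hneg := (h.half_period hp ha hb hA hB hKA hKB hab ht).1
    have := h.lintegral_slowness_eq hp (t₁ := t + s) (by linarith [hs.1])
      fun r hr => hneg r ⟨hr.1, by linarith [hr.2, hs.2]⟩
    rw [h.eq_of_velocity_eq_zero hp ha hA hKA ht.1 ht.2.le, add_sub_cancel_left] at this
    exact ⟨this, h.neg_le_of_energy hp hb hB hKB _, h.le_of_energy hp ha hA hKA _⟩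
  have hlt : ∀ x ∈ Set.Icc (-B) A, ∀ y ∈ Set.Icc (-B) A,
      ∫⁻ x in Set.Ioo x A, ENNReal.ofReal (slowness p a b K x) = ENNReal.ofReal s →
      ∫⁻ x in Set.Ioo y A, ENNReal.ofReal (slowness p a b K x) = ENNReal.ofReal s → ¬ x < y := by
    intro x hx y hy hxs hys hxy
    have hzero : ∫⁻ x in Set.Ioc x y, ENNReal.ofReal (slowness p a b K x) = 0 := by
      rcases hy.2.eq_or_lt with rfl | hyA
      · rw [← hys] at hxs
        simpa [MeasureTheory.restrict_Ioo_eq_restrict_Ioc] using hxs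
      · rw [← Set.Ioc_union_Ioo_eq_Ioo hxy.le hyA,
          MeasureTheory.lintegral_union measurableSet_Ioo
            (Set.disjoint_left.2 fun z hz hz' => absurd hz.2 (not_le.2 hz'.1)), hys] at hxs
        exact by simpa using hxs
    have hpos : 0 < ∫⁻ x in Set.Ioc x y, ENNReal.ofReal (slowness p a b K x) := by
      rw [MeasureTheory.setLIntegral_pos_iff (measurable_slowness p a b K).ennreal_ofReal]
      refine lt_of_lt_of_le (b := MeasureTheory.volume (Set.Ioo x y)) (by simpa using hxy)
        (MeasureTheory.measure_mono fun z hz => ⟨?_, Set.Ioo_subset_Ioc_self hz⟩)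
      exact (ENNReal.ofReal_pos.2 (slowness_pos hp ha hb hKA hKB
        ⟨hx.1.trans_lt hz.1, hz.2.trans_le hy.2⟩)).ne'
    exact hpos.ne' hzero
  obtain ⟨e₁, m₁⟩ := htime h₁ ht₁
  obtain ⟨e₂, m₂⟩ := htime h₂ ht₂
  exact le_antisymm (not_lt.1 (hlt _ m₂ _ m₁ e₂ e₁)) (not_lt.1 (hlt _ m₁ _ m₂ e₁ e₂))

/-- A full period after a maximum, the solution is back at its maximum. -/
lemma isTurningPoint_add_period (h : IsSolution p a b K v w) (hp : 1 < p) (ha : 0 < a)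
    (hb : 0 < b) (hA : 0 < A) (hB : 0 < B) (hKA : a * A ^ p = K) (hKB : b * B ^ p = K)
    (hab : a ^ (-(1 : ℝ) / p) + b ^ (-(1 : ℝ) / p) = 2) (ht : IsTurningPoint v w t₀) :
    IsTurningPoint v w (t₀ + 2 * pip p) := by
  have h1 := (h.half_period hp ha hb hA hB hKA hKB hab ht).2
  have h2 := (h.neg.half_period hp hb ha hB hA hKB hKA (by rw [add_comm]; exact hab) h1).2
  simpa [IsTurningPoint, two_mul, ← add_assoc] using h2

lemma periodic (h : IsSolution p a b K v w) (hp : 1 < p) (ha : 0 < a) (hb : 0 < b)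
    (hK : 0 < K) (hab : a ^ (-(1 : ℝ) / p) + b ^ (-(1 : ℝ) / p) = 2)
    (ht : IsTurningPoint v w 0) : Function.Periodic v (2 * pip p) := by
  have hp0 : p ≠ 0 := by linarith
  obtain ⟨A, hA, hKA⟩ := exists_pos_mul_rpow_eq hp0 ha hK
  obtain ⟨B, hB, hKB⟩ := exists_pos_mul_rpow_eq hp0 hb hK
  have hpip := pip_pos hp
  have hback : ∀ n : ℕ, IsTurningPoint v w (n * (2 * pip p)) ∧
      IsTurningPoint v w (-(n * (2 * pip p))) := by
    intro n
    induction n with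
    | zero => simpa using ht
    | succ n ih =>
      refine ⟨?_, ?_⟩
      · convert h.isTurningPoint_add_period hp ha hb hA hB hKA hKB hab ih.1 using 1
        push_cast
        ring
      · have h1 : IsTurningPoint (fun t => v (-t)) (fun t => -w (-t)) (n * (2 * pip p)) := by
          simpa [IsTurningPoint] using ih.2
        have h2 := h.comp_neg.isTurningPoint_add_period hp ha hb hA hB hKA hKB hab h1
        have he : -(((n + 1 : ℕ) : ℝ) * (2 * pip p)) = -(n * (2 * pip p) + 2 * pip p) := by
          push_cast
          ring
        rw [he]
        simpa only [IsTurningPoint, neg_eq_zero] using h2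
  have htop : ∀ n : ℤ, IsTurningPoint v w (n * (2 * pip p)) := by
    intro n
    obtain ⟨m, rfl | rfl⟩ := n.eq_nat_or_neg
    · exact_mod_cast (hback m).1
    · simpa using (hback m).2
  intro t
  have h2 : 0 < 2 * pip p := by positivity
  set n : ℤ := ⌊t / (2 * pip p)⌋ with hn
  have hn0 : n * (2 * pip p) ≤ t := (le_div_iff₀ h2).1 (Int.floor_le _)
  have hn1 : t < (n + 1) * (2 * pip p) := (div_lt_iff₀ h2).1 (Int.lt_floor_add_one _)
  have hnext : IsTurningPoint v w (n * (2 * pip p) + 2 * pip p) :=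
    h.isTurningPoint_add_period hp ha hb hA hB hKA hKB hab (htop n)
  rcases le_total (t - n * (2 * pip p)) (pip p) with hle | hle
  · have := eq_on_half_period h h hp ha hb hA hB hKA hKB hab hnext (htop n)
      (s := t - n * (2 * pip p)) ⟨by linarith, hle⟩
    convert this using 2 <;> ring
  · have := eq_on_half_period h.neg h.neg hp hb ha hB hA hKB hKA (by rw [add_comm]; exact hab)
      (h.half_period hp ha hb hA hB hKA hKB hab hnext).2
      (h.half_period hp ha hb hA hB hKA hKB hab (htop n)).2
      (s := t - n * (2 * pip p) - pip p) ⟨by linarith, by linarith⟩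
    convert neg_injective this using 2 <;> ring

end IsSolution

/-- Let `v` solve `(φ_p(v'))' + a₁ φ_p(v⁺) − b₁ φ_p(v⁻) = 0` with
`v(0) = (p−1)^{1/p}`, `v'(0) = 0`, and let `u = φ_p(v')`. Then
`q⁻¹|u|^q + p⁻¹(a₁|v⁺|^p + b₁|v⁻|^p) ≡ a₁/q`, and `v`, `u` are `2π_p`-periodic. -/
theorem energy_identity_and_periodicity
    (p q a₁ b₁ : ℝ) (v v' : ℝ → ℝ)
    (hp : 2 ≤ p) (hq : q = p / (p - 1))
    (ha₁ : 0 < a₁) (hb₁ : 0 < b₁)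
    (hab : a₁ ^ (-(1 : ℝ) / p) + b₁ ^ (-(1 : ℝ) / p) = 2)
    (hv : ∀ t, HasDerivAt v (v' t) t)
    (hode : ∀ t, HasDerivAt (fun s => phi p (v' s))
      (-a₁ * phi p (max (v t) 0) + b₁ * phi p (max (-v t) 0)) t)
    (hv0 : v 0 = (p - 1) ^ (1 / p)) (hv'0 : v' 0 = 0)
    (u : ℝ → ℝ) (hu : u = fun t => phi p (v' t)) :
    (∀ t : ℝ, q⁻¹ * |u t| ^ q
        + p⁻¹ * (a₁ * |max (v t) 0| ^ p + b₁ * |max (-v t) 0| ^ p) = a₁ / q) ∧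
    Function.Periodic v (2 * pip p) ∧ Function.Periodic u (2 * pip p) := by
  have hp1 : 1 < p := by linarith
  have hp0 : p ≠ 0 := by linarith
  have hq0 : q ≠ 0 := by
    rw [hq]
    exact div_ne_zero hp0 (by linarith)
  have hpq : p = (p - 1) * q := by
    rw [hq, mul_div_cancel₀]
    linarith
  have hsol := isSolution_of_hasDerivAt hp hv hode
  have hv0pos : 0 < v 0 := hv0 ▸ Real.rpow_pos_of_pos (by linarith) _
  have hK : (p - 1) * |v' 0| ^ p + potential p a₁ b₁ (v 0) = (p - 1) * a₁ := by
    rw [hv'0, abs_zero, Real.zero_rpow hp0, potential_of_nonneg (by linarith) hv0pos.le, hv0,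
      ← Real.rpow_mul (by linarith), one_div_mul_cancel hp0, Real.rpow_one]
    ring
  rw [hK] at hsol
  have hper := hsol.periodic hp1 ha₁ hb₁ (mul_pos (by linarith) ha₁) hab ⟨hv'0, hv0pos⟩
  refine ⟨fun t => ?_, hper, fun t => ?_⟩
  · have h := hsol.energy t
    rw [potential] at h
    have hp1' : p - 1 ≠ 0 := by linarith
    rw [hu, abs_phi_rpow_conj hp1 hq, abs_of_nonneg (le_max_right (v t) 0),
      abs_of_nonneg (le_max_right (-v t) 0)]
    have hinv : p⁻¹ = (p - 1)⁻¹ * q⁻¹ := by rw [← mul_inv, ← hpq]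
    rw [hinv]
    field_simp
    linear_combination h
  · have hshift : HasDerivAt v (v' (t + 2 * pip p)) t :=
      ((hv (t + 2 * pip p)).comp_add_const t (2 * pip p)).congr_of_eventuallyEq
        (Filter.Eventually.of_forall fun s => (hper s).symm)
    rw [hu]
    simp only [hshift.unique (hv t)]
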